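/- Let X be a finite alphabet and Ψ = {S_j : X* → ℝ^p | j ∈ J} a family of formal power series, and suppose for some N > 0 that rank H_{Ψ,N,N} = rank H_{Ψ,N,N+1} = rank H_{Ψ,N+1,N}. Then any two minimal (2N+1)-partial representations of Ψ are isomorphic: if R and R' are both (2N+1)-partial representations of Ψ whose dimensions are minimal among all (2N+1)-partial representations of Ψ, then there exists a representation isomorphism T : R → R'. -/

import Mathlib

open Matrix

section PowerSeriesDefs

variable {X J : Type*} {p n : ℕ}

/-- `A_w = A_{σ_k} ⋯ A_{σ_1}` for the word `w = σ_1 ⋯ σ_k`. -/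
def wordProd {n : ℕ} (A : X → Matrix (Fin n) (Fin n) ℝ) : List X → Matrix (Fin n) (Fin n) ℝ
  | [] => 1
  | σ :: w => wordProd A w * A σ

/-- Column of the full Hankel matrix of the family `S`, indexed by `(w, j)`. -/
def hankelCol (S : J → List X → Fin p → ℝ) (w : List X) (j : J) : List X × Fin p → ℝ :=
  fun vi => S j (w ++ vi.1) vi.2

/-- Linear span of the columns of the full Hankel matrix `H_Ψ`. -/
def fullHankelSpan (S : J → List X → Fin p → ℝ) : Submodule ℝ (List X × Fin p → ℝ) :=
  Submodule.span ℝ (Set.range fun wj : List X × J => hankelCol S wj.1 wj.2)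

/-- Column of the sub-Hankel matrix `H_{Ψ,M,K}` (rows restricted to `|v| ≤ M`). -/
def hankelColTrunc (S : J → List X → Fin p → ℝ) (M : ℕ) (w : List X) (j : J) :
    {v : List X // v.length ≤ M} × Fin p → ℝ :=
  fun vi => S j (w ++ vi.1.1) vi.2

/-- `rank H_{Ψ,M,K}` : dimension of the span of the columns of the sub-Hankel matrix
whose rows are indexed by `(v,i)` with `|v| ≤ M` and whose columns are indexed by
`(w,j)` with `|w| ≤ K`. -/
noncomputable def hankelRank (S : J → List X → Fin p → ℝ) (M K : ℕ) : ℕ :=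
  Module.finrank ℝ (Submodule.span ℝ
    (Set.range fun wj : {w : List X // w.length ≤ K} × J =>
      hankelColTrunc S M wj.1.1 wj.2))

/-- `R = (ℝⁿ, {A_σ}, B, C)` is an `N`-partial representation of the family `S`. -/
def IsPartialRep (S : J → List X → Fin p → ℝ) (N : ℕ)
    (A : X → Matrix (Fin n) (Fin n) ℝ) (B : J → Fin n → ℝ)
    (C : Matrix (Fin p) (Fin n) ℝ) : Prop :=
  ∀ (j : J) (w : List X), w.length ≤ N → S j w = C.mulVec ((wordProd A w).mulVec (B j))

/-- `R = (ℝⁿ, {A_σ}, B, C)` is a (complete) representation of the family `S`. -/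
def IsRep (S : J → List X → Fin p → ℝ)
    (A : X → Matrix (Fin n) (Fin n) ℝ) (B : J → Fin n → ℝ)
    (C : Matrix (Fin p) (Fin n) ℝ) : Prop :=
  ∀ (j : J) (w : List X), S j w = C.mulVec ((wordProd A w).mulVec (B j))

/-- Reachability: the span of the vectors `A_w B_j` is the whole state space. -/
def IsReachable (A : X → Matrix (Fin n) (Fin n) ℝ) (B : J → Fin n → ℝ) : Prop :=
  Submodule.span ℝ
    {x : Fin n → ℝ | ∃ (w : List X) (j : J), x = (wordProd A w).mulVec (B j)} = ⊤

/-- Observability: the intersection of the kernels of the maps `C A_w` is trivial. -/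
def IsObservable (A : X → Matrix (Fin n) (Fin n) ℝ)
    (C : Matrix (Fin p) (Fin n) ℝ) : Prop :=
  ∀ x : Fin n → ℝ, (∀ w : List X, C.mulVec ((wordProd A w).mulVec x) = 0) → x = 0

end PowerSeriesDefs

/-- `T` is a representation morphism from `(ℝⁿ, A, B, C)` to `(ℝ^{n'}, A', B', C')`. -/
def IsRepMorphism {X J : Type*} {p n n' : ℕ}
    (A : X → Matrix (Fin n) (Fin n) ℝ) (B : J → Fin n → ℝ)
    (C : Matrix (Fin p) (Fin n) ℝ)
    (A' : X → Matrix (Fin n') (Fin n') ℝ) (B' : J → Fin n' → ℝ)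
    (C' : Matrix (Fin p) (Fin n') ℝ)
    (T : Matrix (Fin n') (Fin n) ℝ) : Prop :=
  (∀ σ : X, T * A σ = A' σ * T) ∧ (∀ j : J, T.mulVec (B j) = B' j) ∧ C = C' * T

section PartialRealization

variable {X J : Type*} {p n : ℕ}

instance finite_words_length_le [Finite X] (M : ℕ) : Finite {v : List X // v.length ≤ M} :=
  (List.finite_length_le X M).to_subtype

lemma wordProd_append (A : X → Matrix (Fin n) (Fin n) ℝ) (u v : List X) :
    wordProd A (u ++ v) = wordProd A v * wordProd A u := by
  induction u with
  | nil => simp [wordProd]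
  | cons σ u ih => simp [wordProd, ih, Matrix.mul_assoc]

lemma wordProd_mulVec_equiv {V : Type*} [AddCommGroup V] [Module ℝ V]
    (e : V ≃ₗ[ℝ] (Fin n → ℝ)) (f : X → V →ₗ[ℝ] V) (A : X → Matrix (Fin n) (Fin n) ℝ)
    (hA : ∀ σ x, A σ *ᵥ e x = e (f σ x)) (w : List X) (x : V) :
    wordProd A w *ᵥ e x = e (w.foldl (fun y σ => f σ y) x) := by
  induction w generalizing x with
  | nil => simp [wordProd]
  | cons σ w ih => rw [wordProd, ← Matrix.mulVec_mulVec, hA, ih, List.foldl_cons]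

/-- A coordinate-free partial representation on a finite-dimensional space `V` yields a matrix
representation of dimension `finrank V`. -/
lemma exists_isPartialRep_of_linearMap {V : Type*} [AddCommGroup V] [Module ℝ V]
    [FiniteDimensional ℝ V] (hn : Module.finrank ℝ V = n) (S : J → List X → Fin p → ℝ) (N : ℕ)
    (f : X → V →ₗ[ℝ] V) (b : J → V) (c : V →ₗ[ℝ] (Fin p → ℝ))
    (h : ∀ j w, w.length ≤ N → S j w = c (w.foldl (fun y σ => f σ y) (b j))) :
    ∃ (A : X → Matrix (Fin n) (Fin n) ℝ) (B : J → Fin n → ℝ) (C : Matrix (Fin p) (Fin n) ℝ),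
      IsPartialRep S N A B C := by
  subst hn
  let e := (Module.finBasis ℝ V).equivFun
  refine ⟨fun σ => LinearMap.toMatrix' (e.toLinearMap ∘ₗ f σ ∘ₗ e.symm.toLinearMap),
    fun j => e (b j), LinearMap.toMatrix' (c ∘ₗ e.symm.toLinearMap), fun j w hw => ?_⟩
  rw [wordProd_mulVec_equiv e f _ (fun σ x => by simp [LinearMap.toMatrix'_mulVec]), h j w hw]
  simp [LinearMap.toMatrix'_mulVec]

/-- The column space of the sub-Hankel matrix `H_{Ψ,M,K}`. -/
def hankelSpan (S : J → List X → Fin p → ℝ) (M K : ℕ) :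
    Submodule ℝ ({v : List X // v.length ≤ M} × Fin p → ℝ) :=
  Submodule.span ℝ (Set.range fun wj : {w : List X // w.length ≤ K} × J =>
    hankelColTrunc S M wj.1.1 wj.2)

lemma hankelColTrunc_mem_hankelSpan (S : J → List X → Fin p → ℝ) {M K : ℕ} {w : List X}
    (hw : w.length ≤ K) (j : J) : hankelColTrunc S M w j ∈ hankelSpan S M K :=
  Submodule.subset_span ⟨(⟨w, hw⟩, j), rfl⟩

lemma hankelSpan_le_iff {S : J → List X → Fin p → ℝ} {M K : ℕ}
    {U : Submodule ℝ ({v : List X // v.length ≤ M} × Fin p → ℝ)} :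
    hankelSpan S M K ≤ U ↔ ∀ w j, w.length ≤ K → hankelColTrunc S M w j ∈ U := by
  rw [hankelSpan, Submodule.span_le]
  constructor
  · exact fun h w j hw => h ⟨(⟨w, hw⟩, j), rfl⟩
  · rintro h _ ⟨⟨⟨w, hw⟩, j⟩, rfl⟩
    exact h w j hw

lemma hankelSpan_mono (S : J → List X → Fin p → ℝ) (M : ℕ) {K L : ℕ} (h : K ≤ L) :
    hankelSpan S M K ≤ hankelSpan S M L :=
  hankelSpan_le_iff.2 fun _ j hw => hankelColTrunc_mem_hankelSpan S (hw.trans h) j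

/-- Restriction of columns from rows `|v| ≤ M + 1` to rows `|v| ≤ M`. -/
def rowRestrict (X : Type*) (p M : ℕ) :
    ({v : List X // v.length ≤ M + 1} × Fin p → ℝ) →ₗ[ℝ]
      ({v : List X // v.length ≤ M} × Fin p → ℝ) :=
  LinearMap.funLeft ℝ ℝ fun vi => (⟨vi.1.1, vi.1.2.trans M.le_succ⟩, vi.2)

/-- The left shift by the letter `σ`, sending `f` to `v ↦ f (σ v)`. -/
def rowShift (p M : ℕ) (σ : X) :
    ({v : List X // v.length ≤ M + 1} × Fin p → ℝ) →ₗ[ℝ]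
      ({v : List X // v.length ≤ M} × Fin p → ℝ) :=
  LinearMap.funLeft ℝ ℝ fun vi => (⟨σ :: vi.1.1, Nat.succ_le_succ vi.1.2⟩, vi.2)

lemma rowShift_hankelColTrunc (S : J → List X → Fin p → ℝ) (M : ℕ) (σ : X) (w : List X) (j : J) :
    rowShift p M σ (hankelColTrunc S (M + 1) w j) = hankelColTrunc S M (w ++ [σ]) j := by
  ext vi
  simp [rowShift, hankelColTrunc, LinearMap.funLeft_apply]

lemma map_rowRestrict_hankelSpan (S : J → List X → Fin p → ℝ) (M K : ℕ) :
    (hankelSpan S (M + 1) K).map (rowRestrict X p M) = hankelSpan S M K := by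
  rw [hankelSpan, Submodule.map_span, ← Set.range_comp]
  rfl

lemma map_rowShift_hankelSpan_le (S : J → List X → Fin p → ℝ) (M K : ℕ) (σ : X) :
    (hankelSpan S (M + 1) K).map (rowShift p M σ) ≤ hankelSpan S M (K + 1) := by
  rw [Submodule.map_le_iff_le_comap, hankelSpan_le_iff]
  intro w j hw
  rw [Submodule.mem_comap, rowShift_hankelColTrunc]
  exact hankelColTrunc_mem_hankelSpan S (by simpa using hw) j

/-- Under the rank condition the column space of `H_{Ψ,N,N}` carries a `(2N+1)`-partial
representation. -/
lemma exists_isPartialRep_hankelRank [Finite X] (S : J → List X → Fin p → ℝ) (N : ℕ)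
    (h1 : hankelRank S N N = hankelRank S N (N + 1))
    (h2 : hankelRank S N N = hankelRank S (N + 1) N) :
    ∃ (A : X → Matrix (Fin (hankelRank S N N)) (Fin (hankelRank S N N)) ℝ)
      (B : J → Fin (hankelRank S N N) → ℝ) (C : Matrix (Fin p) (Fin (hankelRank S N N)) ℝ),
      IsPartialRep S (2 * N + 1) A B C := by
  have hcols : hankelSpan S N N = hankelSpan S N (N + 1) :=
    Submodule.eq_of_le_of_finrank_eq (hankelSpan_mono S N N.le_succ) h1
  let ρ : hankelSpan S (N + 1) N →ₗ[ℝ] hankelSpan S N N :=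
    (rowRestrict X p N).restrict fun x hx => by
      rw [← map_rowRestrict_hankelSpan]
      exact Submodule.mem_map_of_mem hx
  have hsurj : Function.Surjective ρ := by
    rintro ⟨y, hy⟩
    rw [← map_rowRestrict_hankelSpan] at hy
    obtain ⟨x, hx, rfl⟩ := hy
    exact ⟨⟨x, hx⟩, rfl⟩
  have hinj : Function.Injective ρ :=
    (LinearMap.injective_iff_surjective_of_finrank_eq_finrank h2.symm).2 hsurj
  let e : hankelSpan S (N + 1) N ≃ₗ[ℝ] hankelSpan S N N := LinearEquiv.ofBijective ρ ⟨hinj, hsurj⟩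
  let shift (σ : X) : hankelSpan S (N + 1) N →ₗ[ℝ] hankelSpan S N N :=
    (rowShift p N σ).restrict fun x hx => by
      rw [hcols]
      exact map_rowShift_hankelSpan_le S N N σ (Submodule.mem_map_of_mem hx)
  let f (σ : X) : hankelSpan S N N →ₗ[ℝ] hankelSpan S N N := shift σ ∘ₗ e.symm.toLinearMap
  let c : hankelSpan S N N →ₗ[ℝ] (Fin p → ℝ) :=
    (LinearMap.funLeft ℝ ℝ fun i => (⟨[], N.zero_le⟩, i)) ∘ₗ (hankelSpan S N N).subtype
  let col (w : List X) (hw : w.length ≤ N) (j : J) : hankelSpan S N N :=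
    ⟨hankelColTrunc S N w j, hankelColTrunc_mem_hankelSpan S hw j⟩
  have he_col (w hw j) : e.symm (col w hw j) =
      ⟨hankelColTrunc S (N + 1) w j, hankelColTrunc_mem_hankelSpan S hw j⟩ := by
    rw [LinearEquiv.symm_apply_eq]
    rfl
  have he_apply (x : hankelSpan S N N) (v : List X) (hv : v.length ≤ N) (i : Fin p) :
      (e.symm x).1 (⟨v, hv.trans N.le_succ⟩, i) = x.1 (⟨v, hv⟩, i) := by
    conv_rhs => rw [← e.apply_symm_apply x]
    rfl
  have hreach (u w : List X) (j : J) (h : (w ++ u).length ≤ N) :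
      u.foldl (fun y σ => f σ y) (col w (by grind) j) = col (w ++ u) h j := by
    induction u generalizing w with
    | nil => simp
    | cons σ u ih =>
      have hw : w.length ≤ N := by grind
      have hstep : f σ (col w hw j) = col (w ++ [σ]) (by grind) j := by
        apply Subtype.ext
        change rowShift p N σ (e.symm (col w hw j)).1 = _
        rw [he_col w hw]
        exact rowShift_hankelColTrunc S N σ w j
      rw [List.foldl_cons, hstep, ih (w ++ [σ]) (by simpa using h)]
      simp [col]
  have hobs (v : List X) (hv : v.length ≤ N + 1) (x : hankelSpan S N N) (i : Fin p) :
      c (v.foldl (fun y σ => f σ y) x) i = (e.symm x).1 (⟨v, hv⟩, i) := by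
    induction v generalizing x with
    | nil => exact (he_apply x [] N.zero_le i).symm
    | cons σ v ih =>
      have hv' : v.length ≤ N := by simpa using hv
      rw [List.foldl_cons, ih (hv'.trans N.le_succ), he_apply _ v hv']
      rfl
  refine exists_isPartialRep_of_linearMap (V := hankelSpan S N N) rfl S (2 * N + 1) f
    (col [] N.zero_le) c fun j w hw => ?_
  have htake : ([] ++ w.take N).length ≤ N := by simp
  ext i
  conv_rhs => rw [← List.take_append_drop N w, List.foldl_append, hreach _ [] j htake]
  rw [hobs _ (by simp; omega), he_col _ htake]
  simp [hankelColTrunc]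

/-- The map sending a state `x` to its outputs `C A_v x` along words of length at most `M`. -/
def obsMap (A : X → Matrix (Fin n) (Fin n) ℝ) (C : Matrix (Fin p) (Fin n) ℝ) (M : ℕ) :
    (Fin n → ℝ) →ₗ[ℝ] ({v : List X // v.length ≤ M} × Fin p → ℝ) :=
  LinearMap.pi fun vi => LinearMap.proj vi.2 ∘ₗ (C * wordProd A vi.1.1).mulVecLin

lemma obsMap_apply (A : X → Matrix (Fin n) (Fin n) ℝ) (C : Matrix (Fin p) (Fin n) ℝ) (M : ℕ)
    (x : Fin n → ℝ) (vi) : obsMap A C M x vi = (C *ᵥ (wordProd A vi.1.1 *ᵥ x)) vi.2 := by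
  simp [obsMap]

lemma IsPartialRep.obsMap_wordProd {S : J → List X → Fin p → ℝ} {L M : ℕ}
    {A : X → Matrix (Fin n) (Fin n) ℝ} {B : J → Fin n → ℝ} {C : Matrix (Fin p) (Fin n) ℝ}
    (h : IsPartialRep S L A B C) {w : List X} (hw : w.length + M ≤ L) (j : J) :
    obsMap A C M (wordProd A w *ᵥ B j) = hankelColTrunc S M w j := by
  ext ⟨⟨v, hv⟩, i⟩
  rw [obsMap_apply, hankelColTrunc, h j (w ++ v) (by simp; omega), wordProd_append,
    ← Matrix.mulVec_mulVec]

/-- A `2N`-partial representation of dimension at most the Hankel rank has an injective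
observability map, with range the column space of the Hankel matrix. -/
lemma IsPartialRep.obsMap_injective_and_range [Finite X] {S : J → List X → Fin p → ℝ} {L N : ℕ}
    {A : X → Matrix (Fin n) (Fin n) ℝ} {B : J → Fin n → ℝ} {C : Matrix (Fin p) (Fin n) ℝ}
    (h : IsPartialRep S L A B C) (hL : 2 * N ≤ L) (hn : n ≤ hankelRank S N N) :
    Function.Injective (obsMap A C N) ∧ LinearMap.range (obsMap A C N) = hankelSpan S N N := by
  have hle : hankelSpan S N N ≤ LinearMap.range (obsMap A C N) :=
    hankelSpan_le_iff.2 fun w j hw => ⟨_, h.obsMap_wordProd (by omega) j⟩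
  have hrank : hankelRank S N N ≤ Module.finrank ℝ (LinearMap.range (obsMap A C N)) :=
    Submodule.finrank_mono hle
  have hnull := LinearMap.finrank_range_add_finrank_ker (obsMap A C N)
  rw [Module.finrank_fin_fun] at hnull
  constructor
  · rw [← LinearMap.ker_eq_bot, ← Submodule.finrank_eq_zero (R := ℝ)]
    omega
  · refine (Submodule.eq_of_le_of_finrank_le hle ?_).symm
    change _ ≤ hankelRank S N N
    omega

/-- States reached along words of length at most `N` span the whole state space. -/
lemma IsPartialRep.span_reachable_eq_top {S : J → List X → Fin p → ℝ} {L N : ℕ}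
    {A : X → Matrix (Fin n) (Fin n) ℝ} {B : J → Fin n → ℝ} {C : Matrix (Fin p) (Fin n) ℝ}
    (h : IsPartialRep S L A B C) (hL : 2 * N ≤ L) (hinj : Function.Injective (obsMap A C N))
    (hrange : LinearMap.range (obsMap A C N) = hankelSpan S N N) :
    Submodule.span ℝ (Set.range fun wj : {w : List X // w.length ≤ N} × J =>
      wordProd A wj.1.1 *ᵥ B wj.2) = ⊤ := by
  apply Submodule.map_injective_of_injective hinj
  rw [Submodule.map_top, hrange, Submodule.map_span, ← Set.range_comp, hankelSpan]
  congr 2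
  ext1 ⟨⟨w, hw⟩, j⟩
  exact h.obsMap_wordProd (by dsimp only; omega) j

end PartialRealization

/-- under the rank condition, any two minimal `(2N+1)`-partial
representations of `Ψ` are isomorphic. -/
theorem stmt4 {X J : Type*} [Fintype X] {p : ℕ} (S : J → List X → Fin p → ℝ)
    (N : ℕ) (hN : 0 < N)
    (h1 : hankelRank S N N = hankelRank S N (N + 1))
    (h2 : hankelRank S N N = hankelRank S (N + 1) N)
    (n n' : ℕ)
    (A : X → Matrix (Fin n) (Fin n) ℝ) (B : J → Fin n → ℝ)
    (C : Matrix (Fin p) (Fin n) ℝ)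
    (A' : X → Matrix (Fin n') (Fin n') ℝ) (B' : J → Fin n' → ℝ)
    (C' : Matrix (Fin p) (Fin n') ℝ)
    (hpart : IsPartialRep S (2 * N + 1) A B C)
    (hpart' : IsPartialRep S (2 * N + 1) A' B' C')
    (hmin : ∀ (n'' : ℕ) (A'' : X → Matrix (Fin n'') (Fin n'') ℝ)
      (B'' : J → Fin n'' → ℝ) (C'' : Matrix (Fin p) (Fin n'') ℝ),
      IsPartialRep S (2 * N + 1) A'' B'' C'' → n ≤ n'')
    (hmin' : ∀ (n'' : ℕ) (A'' : X → Matrix (Fin n'') (Fin n'') ℝ)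
      (B'' : J → Fin n'' → ℝ) (C'' : Matrix (Fin p) (Fin n'') ℝ),
      IsPartialRep S (2 * N + 1) A'' B'' C'' → n' ≤ n'') :
    ∃ T : Matrix (Fin n') (Fin n) ℝ,
      IsRepMorphism A B C A' B' C' T ∧ Function.Bijective T.mulVec := by
  obtain ⟨A₀, B₀, C₀, h₀⟩ := exists_isPartialRep_hankelRank S N h1 h2
  obtain ⟨hinj, hrange⟩ := hpart.obsMap_injective_and_range (N := N) (by omega)
    (hmin _ A₀ B₀ C₀ h₀)
  obtain ⟨hinj', hrange'⟩ := hpart'.obsMap_injective_and_range (N := N) (by omega)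
    (hmin' _ A₀ B₀ C₀ h₀)
  let e : (Fin n → ℝ) ≃ₗ[ℝ] (Fin n' → ℝ) := LinearEquiv.ofInjective _ hinj ≪≫ₗ
    LinearEquiv.ofEq _ _ (hrange.trans hrange'.symm) ≪≫ₗ (LinearEquiv.ofInjective _ hinj').symm
  have he (x) : obsMap A' C' N (e x) = obsMap A C N x :=
    congrArg Subtype.val (LinearEquiv.apply_symm_apply (LinearEquiv.ofInjective _ hinj') _)
  have he_reach (w : List X) (hw : w.length ≤ N + 1) (j : J) :
      e (wordProd A w *ᵥ B j) = wordProd A' w *ᵥ B' j := by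
    apply hinj'
    rw [he, hpart.obsMap_wordProd (by omega), hpart'.obsMap_wordProd (by omega)]
  have hT (x) : LinearMap.toMatrix' e.toLinearMap *ᵥ x = e x := LinearMap.toMatrix'_mulVec _ _
  refine ⟨LinearMap.toMatrix' e.toLinearMap, ⟨fun σ => ?_, fun j => ?_, ?_⟩, ?_⟩
  · apply Matrix.toLin'.injective
    refine LinearMap.ext_on_range (hpart.span_reachable_eq_top (by omega) hinj hrange) ?_
    rintro ⟨⟨w, hw⟩, j⟩
    have hsnoc := he_reach (w ++ [σ]) (by simpa using hw) j
    simp only [wordProd_append, wordProd, one_mul, ← Matrix.mulVec_mulVec] at hsnoc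
    simp only [Matrix.toLin'_apply, ← Matrix.mulVec_mulVec, hT, hsnoc,
      he_reach w (hw.trans N.le_succ)]
  · simpa [hT, wordProd] using he_reach [] (Nat.zero_le _) j
  · refine Matrix.ext_of_mulVec_single fun k => ?_
    ext i
    have hout := congrFun (he (Pi.single k 1)) (⟨[], N.zero_le⟩, i)
    simp only [obsMap_apply, wordProd, Matrix.one_mulVec] at hout
    rw [← Matrix.mulVec_mulVec, hT, hout]
  · rw [show (LinearMap.toMatrix' e.toLinearMap).mulVec = e from funext hT]
    exact e.bijective
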